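/- Let $(M,g)$ be a real-analytic four-dimensional Lorentzian manifold (signature $+---$, not necessarily Einstein) with a real-analytic trivialized spin structure, $g_{ab}=\epsilon_{AB}\bar\epsilon_{A'B'}$, Levi-Civita (spin) connection $\nabla_{AA'}$ and Weyl spinor $\Psi_{ABCD}$, and let $(o^A,\iota^A)$ be a smooth spin dyad on $M$, $o_A\iota^A=1$. Put $l_a=o_A\bar o_{A'}$, $n_a=\iota_A\bar\iota_{A'}$, $m_a=o_A\bar\iota_{A'}$, $\bar m_a=\iota_A\bar o_{A'}$, let $\epsilon,\beta,\rho,\tau,\epsilon',\beta',\rho',\tau'$ be the usual GHP spin coefficients of the dyad, and set $$\omega_a=-\epsilon n_a+\epsilon' l_a-\beta' m_a+\beta\bar m_a,\qquad B_a=-\rho n_a+\tau\bar m_a,\qquad f_a=\rho n_a+\rho' l_a-\tau' m_a-\tau\bar m_a .$$ For a scalar field $\psi$ of GHP weight $\{p,0\}$ and conformal weight $w$ let $\mathcal C_{AA'}\psi=\nabla_{AA'}\psi+\big(w f_{AA'}+p(\omega_{AA'}+B_{AA'})\big)\psi$ and $\tilde{\mathcal C}_{A'}\psi=o^A\mathcal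 C_{AA'}\psi$. Assume that $o^A$ is a shear-free ray, $o^Ao^B\nabla_{AA'}o_B=0$, and a repeated principal spinor, $\Psi_{ABCD}o^Bo^Co^D=0$. Let $\phi$ (nowhere zero) and $\eta$ be smooth complex scalar fields on $M$ with $$f_{AA'}=\nabla_{AA'}\log\phi-o_A\tilde{\mathcal C}_{A'}\eta ,$$ where $\nabla_{AA'}\log\phi=\phi^{-1}\nabla_{AA'}\phi$ and $\tilde{\mathcal C}_{A'}\eta$ is formed with $p=-2$, $w=-1$. Let $K_{AB}=K_2\,o_Ao_B-2K_1\,o_{(A}\iota_{B)}$, with smooth complex $K_1,K_2$, be a projected Killing spinor, i.e. $o^A\nabla_{A'(A}K_{BC)}=0$, and assume that $K_1=c\,\phi^{-1}$ for a constant $c\in\mathbb C$ (possibly zero). Then the symmetric spinor field $\varphi_{AB}=-2\phi^3K_{AB}$ solves the source-free Maxwell equations $\nabla^{A'A}\varphi_{AB}=0$, and the complex 2-form $F_{ab}=\varphi_{AB}\bar\epsilon_{A'B'}$ is closed. -/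

import Mathlib

open scoped Manifold ContDiff

noncomputable section

namespace SpinGeom

/-- The model space of a four-dimensional manifold. -/
abbrev E4 : Type := EuclideanSpace ℝ (Fin 4)

/-- Diagonal entries of the Minkowski matrix, signature `(+,-,-,-)`. -/
def mink (a : Fin 4) : ℝ := if a = 0 then 1 else -1

section Metric

variable (M : Type*) [TopologicalSpace M] [ChartedSpace E4 M] [IsManifold 𝓘(ℝ, E4) ω M]

/-- A real-analytic Lorentzian metric (signature `(+,-,-,-)`) on a real-analytic 4-manifold. -/
structure LorentzMetric where
  inner (x : M) : TangentSpace 𝓘(ℝ, E4) x →L[ℝ] TangentSpace 𝓘(ℝ, E4) x →L[ℝ] ℝ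
  symm (x : M) (u v : TangentSpace 𝓘(ℝ, E4) x) : inner x u v = inner x v u
  lorentzian (x : M) : ∃ b : Fin 4 → TangentSpace 𝓘(ℝ, E4) x,
    ∀ i j, inner x (b i) (b j) = if i = j then mink i else 0
  contMDiff : ContMDiff 𝓘(ℝ, E4) (𝓘(ℝ, E4).prod 𝓘(ℝ, E4 →L[ℝ] E4 →L[ℝ] ℝ)) ω
    (fun x ↦ Bundle.TotalSpace.mk' (E4 →L[ℝ] E4 →L[ℝ] ℝ)
      (E := fun x ↦ TangentSpace 𝓘(ℝ, E4) x →L[ℝ] TangentSpace 𝓘(ℝ, E4) x →L[ℝ] ℝ) x (inner x))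

end Metric

section Geometry

variable {M : Type*} [TopologicalSpace M] [ChartedSpace E4 M]

/-- Vector fields on `M`. -/
abbrev VField (M : Type*) [TopologicalSpace M] [ChartedSpace E4 M] : Type _ :=
  (x : M) → TangentSpace 𝓘(ℝ, E4) x

/-- A vector field of class `C^n`. -/
def VSmooth (n : WithTop ℕ∞) [IsManifold 𝓘(ℝ, E4) 1 M] (X : VField M) : Prop :=
  ContMDiff 𝓘(ℝ, E4) (𝓘(ℝ, E4).prod 𝓘(ℝ, E4)) n
    (fun x ↦ Bundle.TotalSpace.mk' E4 (E := TangentSpace 𝓘(ℝ, E4)) x (X x))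

/-- Derivative `X f` of a real function. -/
def dirR (X : VField M) (f : M → ℝ) (x : M) : ℝ := mfderiv 𝓘(ℝ, E4) 𝓘(ℝ, ℝ) f x (X x)

/-- Derivative `X f` of a complex function. -/
def dirC (X : VField M) (f : M → ℂ) (x : M) : ℂ := mfderiv 𝓘(ℝ, E4) 𝓘(ℝ, ℂ) f x (X x)

/-- The Lie bracket `[X, Y]`. -/
def bracket (X Y : VField M) : VField M := VectorField.mlieBracket 𝓘(ℝ, E4) X Y

end Geometry

section Spin

variable {M : Type*} [TopologicalSpace M] [ChartedSpace E4 M] [IsManifold 𝓘(ℝ, E4) ω M]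

/-- `g(X, Y)` as a function. -/
def LorentzMetric.app (g : LorentzMetric M) (X Y : VField M) (x : M) : ℝ := g.inner x (X x) (Y x)

/-- Koszul's formula for the Levi-Civita connection of `g`: the value of `g(∇_X Y, Z)`. -/
def LorentzMetric.leviCivita (g : LorentzMetric M) (X Y Z : VField M) (x : M) : ℝ :=
  (1 / 2) * (dirR X (g.app Y Z) x + dirR Y (g.app X Z) x - dirR Z (g.app X Y) x
    + g.app (bracket X Y) Z x - g.app (bracket X Z) Y x - g.app (bracket Y Z) X x)

/-- A real-analytic spin frame on `(M, g)`, i.e. a symplectic trivialization of the unprimed spinor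
bundle, given by the orthonormal tetrad `e_a` that corresponds to it under the Infeld-van der
Waerden symbols `ivdw` below. Spinors at a point are then elements of `ℂ²`, primed spinors
are elements of the complex conjugate `ℂ²`. -/
structure SpinFrame (g : LorentzMetric M) where
  vec : Fin 4 → VField M
  analytic (a : Fin 4) : VSmooth ω (vec a)
  orthonormal (x : M) (a b : Fin 4) :
    g.inner x (vec a x) (vec b x) = if a = b then mink a else 0

/-- Infeld-van der Waerden symbols `σ^a_{AA'}` (Pauli matrices over `√2`), with
`e_{AA'} = ∑ a, σ^a_{AA'} e_a`. -/
def ivdw (a : Fin 4) : Matrix (Fin 2) (Fin 2) ℂ :=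
  ((Real.sqrt 2 : ℝ) : ℂ)⁻¹ •
    (![!![1, 0; 0, 1], !![0, 1; 1, 0], !![0, -Complex.I; Complex.I, 0], !![1, 0; 0, -1]] a)

/-- The inverse symbols `σ_a^{AA'}`: a vector `v^a e_a` is `v^{AA'} = ∑ a, v^a σ_a^{AA'}`. -/
def ivdwInv (a : Fin 4) (A A' : Fin 2) : ℂ := starRingEnd ℂ (ivdw a A A')

/-- The symplectic form of spin space: both `ε_{AB}` and `ε^{AB}`, and (being real) also
`ε̄_{A'B'}` and `ε̄^{A'B'}`, with `ε_{01} = 1`. -/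
def eps : Matrix (Fin 2) (Fin 2) ℂ := !![0, 1; -1, 0]

/-- Unprimed spinor fields of valence one in a spin frame. -/
abbrev Spinor (M : Type*) : Type _ := M → Fin 2 → ℂ

/-- Covariant spinor fields of valence two, `K_{AB}`, in a spin frame. -/
abbrev Spinor2 (M : Type*) : Type _ := M → Fin 2 → Fin 2 → ℂ

/-- Lowering of the index: `ξ_B = ξ^A ε_{AB}`. -/
def lower (ξ : Spinor M) : Spinor M := fun x B ↦ ∑ A, ξ x A * eps A B

/-- The complex conjugate spinor field `ξ̄^{A'}` (or `ξ̄_{A'}`). -/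
def cc (ξ : Spinor M) : Spinor M := fun x A ↦ starRingEnd ℂ (ξ x A)

/-- A complex scalar field that is smooth. -/
def SSmooth (f : M → ℂ) : Prop := ContMDiff 𝓘(ℝ, E4) 𝓘(ℝ, ℂ) ∞ f

/-- Symmetrization over `n` spinor indices. -/
def symmetrize {n : ℕ} (T : (Fin n → Fin 2) → ℂ) (i : Fin n → Fin 2) : ℂ :=
  ((n.factorial : ℂ))⁻¹ * ∑ π : Equiv.Perm (Fin n), T (i ∘ π)

namespace SpinFrame

variable {g : LorentzMetric M} (S : SpinFrame g)

/-- Connection coefficients of the Levi-Civita connection in the tetrad: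
`∇_{e_c} e_b = ∑ a, Γ_c^a_b e_a`. -/
def conn (c a b : Fin 4) (x : M) : ℝ := mink a * g.leviCivita (S.vec c) (S.vec b) (S.vec a) x

/-- Structure coefficients: `[e_a, e_b] = ∑ d, c_{ab}^d e_d`. -/
def struct (a b d : Fin 4) (x : M) : ℝ := mink d * g.app (bracket (S.vec a) (S.vec b)) (S.vec d) x

/-- Tetrad components `R_{abcd}` of the Riemann tensor, with
`(∇_a ∇_b - ∇_b ∇_a) V^d = R_{abc}^d V^c`. -/
def riemann (a b c d : Fin 4) (x : M) : ℝ :=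
  mink d * (dirR (S.vec a) (S.conn b d c) x - dirR (S.vec b) (S.conn a d c) x
    + ∑ e, (S.conn b e c x * S.conn a d e x - S.conn a e c x * S.conn b d e x
      - S.struct a b e x * S.conn e d c x))

/-- `X_{ABCD} = (1/4) ε̄^{A'B'} ε̄^{C'D'} R_{AA'BB'CC'DD'}`. -/
def curvX (x : M) (i : Fin 4 → Fin 2) : ℂ :=
  (1 / 4) * ∑ A', ∑ B', ∑ C', ∑ D', eps A' B' * eps C' D' *
    ∑ a, ∑ b, ∑ c, ∑ d, ivdw a (i 0) A' * ivdw b (i 1) B' * ivdw c (i 2) C' * ivdw d (i 3) D' *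
      (S.riemann a b c d x : ℂ)

/-- The Weyl spinor `Ψ_{ABCD} = X_{(ABCD)}`. -/
def weyl (x : M) (A B C D : Fin 2) : ℂ := symmetrize (S.curvX x) ![A, B, C, D]

/-- Coefficients of the spinor connection induced by the Levi-Civita connection,
`∇_c ξ^A = e_c ξ^A + ∑ B, γ_c^A_B ξ^B`: the solution of
`∑ a, Γ_c^a_b σ_a^{AA'} = ∑ B, γ_c^A_B σ_b^{BA'} + ∑ B', conj (γ_c^A'_B') σ_b^{AB'}`
with `γ_c^A_A = 0`. -/
def spinConn (c : Fin 4) (A B : Fin 2) (x : M) : ℂ :=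
  (1 / 2) * ∑ a, ∑ b, ∑ A', ivdwInv a A A' * (S.conn c a b x : ℂ) * ivdw b B A'

/-- `∇_{AA'} f` for a scalar field. -/
def nabla0 (f : M → ℂ) (x : M) (A A' : Fin 2) : ℂ := ∑ c, ivdw c A A' * dirC (S.vec c) f x

/-- `∇_{AA'} ξ_B` for a covariant spinor field `ξ_B`. -/
def nabla1 (ξ : Spinor M) (x : M) (A A' B : Fin 2) : ℂ :=
  ∑ c, ivdw c A A' * (dirC (S.vec c) (fun y ↦ ξ y B) x - ∑ D, S.spinConn c D B x * ξ x D)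

/-- `∇_{AA'} K_{BC}` for a covariant spinor field `K_{BC}`. -/
def nabla2 (K : Spinor2 M) (x : M) (A A' B C : Fin 2) : ℂ :=
  ∑ c, ivdw c A A' * (dirC (S.vec c) (fun y ↦ K y B C) x
    - ∑ D, S.spinConn c D B x * K x D C - ∑ D, S.spinConn c D C x * K x B D)

/-- `o^A` is a shear-free ray: `o^A o^B ∇_{AA'} o_B = 0`. -/
def IsShearFreeRay (o : Spinor M) : Prop :=
  ∀ x A', ∑ A, ∑ B, o x A * o x B * S.nabla1 (lower o) x A A' B = 0

/-- `o^A` is a repeated principal spinor: `Ψ_{ABCD} o^B o^C o^D = 0`. -/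
def IsRepeatedPrincipal (o : Spinor M) : Prop :=
  ∀ x A, ∑ B, ∑ C, ∑ D, S.weyl x A B C D * o x B * o x C * o x D = 0

/-- The scalar `ζ^B (α^A β̄^{A'} ∇_{AA'}) ξ_B`. -/
def coef (ζ α β ξ : Spinor M) (x : M) : ℂ :=
  ∑ A, ∑ A', ∑ B, α x A * cc β x A' * ζ x B * S.nabla1 (lower ξ) x A A' B

section Dyad

/- Spin coefficients of a dyad `(o, ι)` with `o_A ι^A = 1`, with respect to
`D = o^A ō^{A'} ∇`, `D' = ι^A ῑ^{A'} ∇`, `δ = o^A ῑ^{A'} ∇`, `δ' = ι^A ō^{A'} ∇`; primed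
coefficients arise from `o ↦ i ι`, `ι ↦ i o`. -/

variable (o ι : Spinor M)

/-- `ρ = o^A δ' o_A`. -/
def rho : M → ℂ := S.coef o ι o o
/-- `τ = o^A D' o_A`. -/
def tau : M → ℂ := S.coef o ι ι o
/-- `ε = ι^A D o_A`. -/
def epsilon : M → ℂ := S.coef ι o o o
/-- `β = ι^A δ o_A`. -/
def beta : M → ℂ := S.coef ι o ι o
/-- `ρ' = - ι^A δ ι_A`. -/
def rho' : M → ℂ := - S.coef ι o ι ι
/-- `τ' = - ι^A D ι_A`. -/
def tau' : M → ℂ := - S.coef ι o o ι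
/-- `ε' = - o^A D' ι_A`. -/
def epsilon' : M → ℂ := - S.coef o ι ι ι
/-- `β' = - o^A δ' ι_A`. -/
def beta' : M → ℂ := - S.coef o ι o ι

/-- The null covectors `l_a = o_A ō_{A'}`, `n_a = ι_A ῑ_{A'}`, `m_a = o_A ῑ_{A'}`,
`m̄_a = ι_A ō_{A'}` are all of the form `α_A β̄_{A'}`. -/
def covec (α β : Spinor M) (x : M) (A A' : Fin 2) : ℂ := lower α x A * cc (lower β) x A'

/-- `ω_a = - ε n_a + ε' l_a - β' m_a + β m̄_a`. -/
def omegaForm (x : M) (A A' : Fin 2) : ℂ :=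
  - S.epsilon o ι x * covec ι ι x A A' + S.epsilon' o ι x * covec o o x A A'
    - S.beta' o ι x * covec o ι x A A' + S.beta o ι x * covec ι o x A A'

/-- `B_a = - ρ n_a + τ m̄_a`. -/
def bForm (x : M) (A A' : Fin 2) : ℂ :=
  - S.rho o ι x * covec ι ι x A A' + S.tau o ι x * covec ι o x A A'

/-- `f_a = ρ n_a + ρ' l_a - τ' m_a - τ m̄_a`. -/
def fForm (x : M) (A A' : Fin 2) : ℂ :=
  S.rho o ι x * covec ι ι x A A' + S.rho' o ι x * covec o o x A A'
    - S.tau' o ι x * covec o ι x A A' - S.tau o ι x * covec ι o x A A'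

/-- The conformal-GHP derivative `C_{AA'} ψ` of a scalar field `ψ` of GHP weight `{p, 0}` and
conformal weight `w`. -/
def confGHP (p w : ℤ) (ψ : M → ℂ) (x : M) (A A' : Fin 2) : ℂ :=
  S.nabla0 ψ x A A'
    + ((w : ℂ) * S.fForm o ι x A A' + (p : ℂ) * (S.omegaForm o ι x A A' + S.bForm o ι x A A')) * ψ x

/-- The projection `C̃_{A'} ψ = o^A C_{AA'} ψ`. -/
def confGHPTilde (p w : ℤ) (ψ : M → ℂ) (x : M) (A' : Fin 2) : ℂ :=
  ∑ A, o x A * S.confGHP o ι p w ψ x A A'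

/-- `f_{AA'} = ∇_{AA'} log φ - o_A C̃_{A'} η` for a nowhere vanishing `φ` (where
`∇ log φ = φ⁻¹ ∇ φ`) and `η` of GHP weight `{-2, 0}` and conformal weight `-1`. -/
def IsDecomposition (φ η : M → ℂ) : Prop :=
  (∀ x, φ x ≠ 0) ∧ ∀ x A A', S.fForm o ι x A A' =
    (φ x)⁻¹ * S.nabla0 φ x A A' - lower o x A * S.confGHPTilde o ι (-2) (-1) η x A'

end Dyad

/-- The projected Killing spinor equation `o^A ∇_{A'(A} K_{BC)} = 0`. -/
def IsProjectedKilling (o : Spinor M) (K : Spinor2 M) : Prop :=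
  ∀ x A' B C, ∑ A, o x A *
    symmetrize (fun i : Fin 3 → Fin 2 ↦ S.nabla2 K x (i 0) A' (i 1) (i 2)) ![A, B, C] = 0

/-- The source-free Maxwell equations `∇^{A'A} φ_{AB} = 0` for a symmetric spinor field. -/
def IsMaxwell (Φ : Spinor2 M) : Prop :=
  (∀ x A B, Φ x A B = Φ x B A) ∧
  ∀ x A' B, ∑ A, ∑ C, ∑ C', eps A C * eps A' C' * S.nabla2 Φ x C C' A B = 0

/-- The complex 2-form `F_{ab} = φ_{AB} ε̄_{A'B'}`. -/
def twoForm (Φ : Spinor2 M) (x : M) (u v : TangentSpace 𝓘(ℝ, E4) x) : ℂ :=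
  ∑ a, ∑ b, ((mink a * g.inner x u (S.vec a x) : ℝ) : ℂ) *
    ((mink b * g.inner x v (S.vec b x) : ℝ) : ℂ) *
    ∑ A, ∑ A', ∑ B, ∑ B', ivdwInv a A A' * ivdwInv b B B' * Φ x A B * eps A' B'

end SpinFrame

/-- The symmetric spinor field `K₂ o_A o_B - 2 K₁ o_{(A} ι_{B)} + K₀ ι_A ι_B`. -/
def ofComponents (o ι : Spinor M) (K0 K1 K2 : M → ℂ) : Spinor2 M := fun x A B ↦
  K2 x * lower o x A * lower o x B
    - 2 * K1 x * ((1 / 2) * (lower o x A * lower ι x B + lower o x B * lower ι x A))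
    + K0 x * lower ι x A * lower ι x B

/-- A complex 2-form `F` is closed: `dF(X, Y, Z) = 0` for all smooth vector fields. -/
def IsClosedForm
    (F : (x : M) → TangentSpace 𝓘(ℝ, E4) x → TangentSpace 𝓘(ℝ, E4) x → ℂ) : Prop :=
  ∀ X Y Z : VField M, VSmooth ∞ X → VSmooth ∞ Y → VSmooth ∞ Z → ∀ x,
    dirC X (fun y ↦ F y (Y y) (Z y)) x + dirC Y (fun y ↦ F y (Z y) (X y)) x
      + dirC Z (fun y ↦ F y (X y) (Y y)) x
      - F x (bracket X Y x) (Z x) - F x (bracket Y Z x) (X x) - F x (bracket Z X x) (Y x) = 0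

end Spin

end SpinGeom

end

open SpinGeom

open scoped Manifold ContDiff

noncomputable section

namespace SpinGeom

section

variable {M : Type*} [TopologicalSpace M] [ChartedSpace E4 M]

section Calculus

variable {f h : M → ℂ} {x : M} (X : VField M)

lemma mdifferentiableAt_fun_add (hf : MDifferentiableAt 𝓘(ℝ, E4) 𝓘(ℝ, ℂ) f x)
    (hh : MDifferentiableAt 𝓘(ℝ, E4) 𝓘(ℝ, ℂ) h x) :
    MDifferentiableAt 𝓘(ℝ, E4) 𝓘(ℝ, ℂ) (fun y ↦ f y + h y) x :=
  hf.add hh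

lemma mdifferentiableAt_fun_mul (hf : MDifferentiableAt 𝓘(ℝ, E4) 𝓘(ℝ, ℂ) f x)
    (hh : MDifferentiableAt 𝓘(ℝ, E4) 𝓘(ℝ, ℂ) h x) :
    MDifferentiableAt 𝓘(ℝ, E4) 𝓘(ℝ, ℂ) (fun y ↦ f y * h y) x :=
  hf.mul hh

lemma dirC_add (hf : MDifferentiableAt 𝓘(ℝ, E4) 𝓘(ℝ, ℂ) f x)
    (hh : MDifferentiableAt 𝓘(ℝ, E4) 𝓘(ℝ, ℂ) h x) :
    dirC X (fun y ↦ f y + h y) x = dirC X f x + dirC X h x := by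
  have := (hf.hasMFDerivAt.add hh.hasMFDerivAt).mfderiv
  exact congrArg (fun L : E4 →L[ℝ] ℂ ↦ L (X x)) this

lemma dirC_sub (hf : MDifferentiableAt 𝓘(ℝ, E4) 𝓘(ℝ, ℂ) f x)
    (hh : MDifferentiableAt 𝓘(ℝ, E4) 𝓘(ℝ, ℂ) h x) :
    dirC X (fun y ↦ f y - h y) x = dirC X f x - dirC X h x := by
  have := (hf.hasMFDerivAt.sub hh.hasMFDerivAt).mfderiv
  exact congrArg (fun L : E4 →L[ℝ] ℂ ↦ L (X x)) this

lemma dirC_mul (hf : MDifferentiableAt 𝓘(ℝ, E4) 𝓘(ℝ, ℂ) f x)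
    (hh : MDifferentiableAt 𝓘(ℝ, E4) 𝓘(ℝ, ℂ) h x) :
    dirC X (fun y ↦ f y * h y) x = f x * dirC X h x + h x * dirC X f x := by
  have := (hf.hasMFDerivAt.mul hh.hasMFDerivAt).mfderiv
  exact congrArg (fun L : E4 →L[ℝ] ℂ ↦ L (X x)) this

@[simp] lemma dirC_const (k : ℂ) : dirC X (fun _ ↦ k) x = 0 := by
  simp only [dirC, mfderiv_const]; rfl

@[simp] lemma dirR_const (k : ℝ) : dirR X (fun _ ↦ k) x = 0 := by
  simp only [dirR, mfderiv_const]; rfl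

lemma mdifferentiableAt_finset_sum {ι : Type*} (s : Finset ι) {F : ι → M → ℂ}
    (hF : ∀ i, MDifferentiableAt 𝓘(ℝ, E4) 𝓘(ℝ, ℂ) (F i) x) :
    MDifferentiableAt 𝓘(ℝ, E4) 𝓘(ℝ, ℂ) (fun y ↦ ∑ i ∈ s, F i y) x := by
  classical
  induction s using Finset.induction_on with
  | empty => simpa using mdifferentiableAt_const
  | insert i s hi ih => simpa only [Finset.sum_insert hi] using! (hF i).add ih

lemma dirC_sum {ι : Type*} (s : Finset ι) {F : ι → M → ℂ}
    (hF : ∀ i, MDifferentiableAt 𝓘(ℝ, E4) 𝓘(ℝ, ℂ) (F i) x) :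
    dirC X (fun y ↦ ∑ i ∈ s, F i y) x = ∑ i ∈ s, dirC X (F i) x := by
  classical
  induction s using Finset.induction_on with
  | empty => simp
  | insert i s hi ih =>
    simp only [Finset.sum_insert hi]
    rw [dirC_add X (hF i) (mdifferentiableAt_finset_sum s hF), ih]

lemma hasMFDerivAt_ofReal {u : M → ℝ} (hu : MDifferentiableAt 𝓘(ℝ, E4) 𝓘(ℝ, ℝ) u x) :
    HasMFDerivAt 𝓘(ℝ, E4) 𝓘(ℝ, ℂ) (fun y ↦ (u y : ℂ)) x
      (Complex.ofRealCLM.comp (mfderiv 𝓘(ℝ, E4) 𝓘(ℝ, ℝ) u x : E4 →L[ℝ] ℝ)) :=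
  (Complex.ofRealCLM.hasMFDerivAt (x := u x)).comp x hu.hasMFDerivAt

lemma mdifferentiableAt_ofReal {u : M → ℝ} (hu : MDifferentiableAt 𝓘(ℝ, E4) 𝓘(ℝ, ℝ) u x) :
    MDifferentiableAt 𝓘(ℝ, E4) 𝓘(ℝ, ℂ) (fun y ↦ (u y : ℂ)) x :=
  (hasMFDerivAt_ofReal hu).mdifferentiableAt

lemma dirC_ofReal {u : M → ℝ} (hu : MDifferentiableAt 𝓘(ℝ, E4) 𝓘(ℝ, ℝ) u x) :
    dirC X (fun y ↦ (u y : ℂ)) x = (dirR X u x : ℂ) :=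
  congrArg (fun L : E4 →L[ℝ] ℂ ↦ L (X x)) (hasMFDerivAt_ofReal hu).mfderiv

lemma SSmooth.mdifferentiableAt [IsManifold 𝓘(ℝ, E4) ω M] {f : M → ℂ} (hf : SSmooth f) (x : M) :
    MDifferentiableAt 𝓘(ℝ, E4) 𝓘(ℝ, ℂ) f x :=
  ContMDiff.mdifferentiableAt hf (by simp)

end Calculus

lemma bracket_swap (X Y : VField M) (x : M) : bracket X Y x = - bracket Y X x :=
  VectorField.mlieBracket_swap_apply

end

section

variable {M : Type*} [TopologicalSpace M] [ChartedSpace E4 M]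
variable [IsManifold 𝓘(ℝ, E4) ω M] {g : LorentzMetric M} (S : SpinFrame g)

lemma mink_mul_self (a : Fin 4) : mink a * mink a = 1 := by
  unfold mink; split_ifs <;> norm_num

namespace SpinFrame

lemma app_vec (a b : Fin 4) : g.app (S.vec a) (S.vec b) = fun _ ↦ if a = b then mink a else 0 :=
  funext fun x ↦ S.orthonormal x a b

lemma app_bracket_swap (X Y Z : VField M) (x : M) :
    g.app (bracket X Y) Z x = - g.app (bracket Y X) Z x := by
  simp only [LorentzMetric.app]
  rw [bracket_swap]
  simp only [map_neg]; rfl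

lemma leviCivita_vec (a b c : Fin 4) (x : M) :
    g.leviCivita (S.vec a) (S.vec b) (S.vec c) x = (1 / 2) *
      (g.app (bracket (S.vec a) (S.vec b)) (S.vec c) x
        - g.app (bracket (S.vec a) (S.vec c)) (S.vec b) x
        - g.app (bracket (S.vec b) (S.vec c)) (S.vec a) x) := by
  simp only [LorentzMetric.leviCivita, app_vec, dirR_const]
  ring

/-- The Levi-Civita connection is metric. -/
lemma mink_conn_antisymm (c a b : Fin 4) (x : M) :
    mink a * S.conn c a b x = - (mink b * S.conn c b a x) := by
  simp only [conn, leviCivita_vec, ← mul_assoc, mink_mul_self]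
  rw [app_bracket_swap (S.vec b) (S.vec a)]
  ring

/-- The Levi-Civita connection is torsion-free. -/
lemma struct_eq (a b d : Fin 4) (x : M) : S.struct a b d x = S.conn a d b x - S.conn b d a x := by
  simp only [conn, struct, leviCivita_vec]
  rw [app_bracket_swap (S.vec b) (S.vec a)]
  ring

lemma conn_diag (c a : Fin 4) (x : M) : S.conn c a a x = 0 := by
  have h := S.mink_conn_antisymm c a a x
  have h0 : mink a ≠ 0 := fun h0 ↦ by simpa [h0] using mink_mul_self a
  have : mink a * S.conn c a a x = 0 := by linarith
  exact (mul_eq_zero.mp this).resolve_left h0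

end SpinFrame

lemma inv_sqrt_two_sq : ((Real.sqrt 2 : ℝ) : ℂ)⁻¹ ^ 2 = 1 / 2 := by
  rw [inv_pow, ← Complex.ofReal_pow, Real.sq_sqrt (by norm_num)]; norm_num

lemma ivdwInv_mul_ivdw_sum (a b : Fin 4) :
    ∑ A, ∑ A', ivdwInv a A A' * ivdw b A A' = if a = b then 1 else 0 := by
  have h := inv_sqrt_two_sq
  generalize hs : ((Real.sqrt 2 : ℝ) : ℂ)⁻¹ = s at h
  have hc : starRingEnd ℂ s = s := by rw [← hs, map_inv₀, Complex.conj_ofReal]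
  fin_cases a <;> fin_cases b <;>
    simp [ivdwInv, ivdw, Fin.sum_univ_two, hs, hc] <;>
    first
    | ring1
    | linear_combination 2 * h
    | linear_combination (- 2 * Complex.I ^ 2) * h - Complex.I_sq

namespace SpinFrame

/-- The spinor connection preserves `ε_{AB}`. -/
lemma spinConn_trace (c : Fin 4) (x : M) : S.spinConn c 0 0 x + S.spinConn c 1 1 x = 0 := by
  have h : S.spinConn c 0 0 x + S.spinConn c 1 1 x =
      (1 / 2) * ∑ a, ∑ b, (S.conn c a b x : ℂ) * ∑ A, ∑ A', ivdwInv a A A' * ivdw b A A' := by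
    simp only [spinConn, ← mul_add, ← Finset.sum_add_distrib, Fin.sum_univ_two]
    refine congrArg _ (Finset.sum_congr rfl fun a _ ↦ Finset.sum_congr rfl fun b _ ↦ ?_)
    ring
  rw [h]
  simp only [ivdwInv_mul_ivdw_sum]
  simp [conn_diag]

end SpinFrame

end

section

variable {M : Type*} [TopologicalSpace M] [ChartedSpace E4 M]
variable [IsManifold 𝓘(ℝ, E4) ω M] {g : LorentzMetric M} (S : SpinFrame g)

lemma symmetrize_three (T : (Fin 3 → Fin 2) → ℂ) (A B C : Fin 2) :
    symmetrize T ![A, B, C] = (1 / 6) * (T ![A, B, C] + T ![A, C, B] + T ![B, A, C]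
      + T ![B, C, A] + T ![C, A, B] + T ![C, B, A]) := by
  have hu : (Finset.univ : Finset (Equiv.Perm (Fin 3))) =
      {1, Equiv.swap 1 2, Equiv.swap 0 1, Equiv.swap 0 1 * Equiv.swap 1 2,
        Equiv.swap 1 2 * Equiv.swap 0 1, Equiv.swap 0 2} := by decide
  have e : ∀ π : Equiv.Perm (Fin 3), ![A, B, C] ∘ π =
      ![![A, B, C] (π 0), ![A, B, C] (π 1), ![A, B, C] (π 2)] := by
    intro π; ext i; fin_cases i <;> rfl
  simp only [symmetrize, hu, e]
  rw [Finset.sum_insert (by decide), Finset.sum_insert (by decide), Finset.sum_insert (by decide),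
    Finset.sum_insert (by decide), Finset.sum_insert (by decide), Finset.sum_singleton]
  have h1 : ∀ i : Fin 3, (Equiv.swap 0 1 * Equiv.swap 1 2 : Equiv.Perm (Fin 3)) i = ![1, 2, 0] i := by
    decide
  have h2 : ∀ i : Fin 3, (Equiv.swap 1 2 * Equiv.swap 0 1 : Equiv.Perm (Fin 3)) i = ![2, 0, 1] i := by
    decide
  have h3 : ∀ i : Fin 3, (Equiv.swap 1 2 : Equiv.Perm (Fin 3)) i = ![0, 2, 1] i := by decide
  have h4 : ∀ i : Fin 3, (Equiv.swap 0 1 : Equiv.Perm (Fin 3)) i = ![1, 0, 2] i := by decide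
  have h5 : ∀ i : Fin 3, (Equiv.swap 0 2 : Equiv.Perm (Fin 3)) i = ![2, 1, 0] i := by decide
  simp only [h1, h2, h3, h4, h5]
  simp [Nat.factorial]
  ring

/-- Pointwise form of the Maxwell equations for `φ³ K`: `D` is the derivative of `K`. -/
lemma maxwell_of_killing_algebra (o ι : Fin 2 → ℂ) (P Q : Fin 2 → Fin 2 → ℂ) (dk₁ dk₂ dφ : Fin 2 → ℂ)
    (k₁ k₂ φ : ℂ) (D : Fin 2 → Fin 2 → Fin 2 → ℂ) (K : Fin 2 → Fin 2 → ℂ)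
    (oL ιL : Fin 2 → ℂ) (ho0 : oL 0 = - o 1) (ho1 : oL 1 = o 0)
    (hi0 : ιL 0 = - ι 1) (hi1 : ιL 1 = ι 0)
    (hdyad : o 0 * ι 1 - o 1 * ι 0 = 1)
    (hPQ : ∀ A, ι 0 * P A 0 + ι 1 * P A 1 = o 0 * Q A 0 + o 1 * Q A 1)
    (hK : ∀ B C, K B C = k₂ * oL B * oL C - k₁ * (oL B * ιL C + oL C * ιL B))
    (hD : ∀ A B C, D A B C = dk₂ A * oL B * oL C + k₂ * (P A B * oL C + oL B * P A C)
      - dk₁ A * (oL B * ιL C + oL C * ιL B)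
      - k₁ * (P A B * ιL C + oL B * Q A C + P A C * ιL B + oL C * Q A B))
    (hφ : φ * ∑ A, ∑ B, ι A * o B * P A B = ∑ A, o A * dφ A)
    (hkil : ∀ B C, ∑ A, o A * (D A B C + D B A C + D C A B) = 0)
    (hk : ∀ A, dk₁ A * φ + k₁ * dφ A = 0) (B : Fin 2) :
    3 * (dφ 1 * K 0 B - dφ 0 * K 1 B) + φ * (D 1 0 B - D 0 1 B) = 0 := by
  have hsymm : ∀ A B C, D A B C = D A C B := by intro A B C; rw [hD, hD]; ring
  set r := ∑ A, ∑ B, ι A * o B * P A B with hr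
  have h1 : ∑ A, ∑ B, ∑ C, ι A * o B * o C * D A B C = 2 * k₁ * r := by
    simp only [hr, hD, Fin.sum_univ_two, ho0, ho1, hi0, hi1]
    linear_combination 2 * k₁ * (ι 0 * o 0 * P 0 0 + ι 0 * o 1 * P 0 1
      + (ι 1 * o 0 * P 1 0 + ι 1 * o 1 * P 1 1)) * hdyad
  have h2 : ∑ A, ∑ B, ∑ C, ι A * o B * ι C * D A B C = ∑ A, ι A * dk₁ A + k₂ * r := by
    simp only [hr, hD, Fin.sum_univ_two, ho0, ho1, hi0, hi1]
    linear_combination (k₂ * (ι 0 * o 0 * P 0 0 + ι 0 * o 1 * P 0 1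
      + (ι 1 * o 0 * P 1 0 + ι 1 * o 1 * P 1 1))
      + (ι 0 * dk₁ 0 + ι 1 * dk₁ 1) * (o 0 * ι 1 - o 1 * ι 0 + 1)) * hdyad
      + k₁ * (o 0 * ι 1 - o 1 * ι 0) * (ι 0 * hPQ 0 + ι 1 * hPQ 1)
  have hoι : ∑ A, ∑ B, o A * ι B * K A B = k₁ := by
    simp only [hK, Fin.sum_univ_two, ho0, ho1, hi0, hi1]
    linear_combination k₁ * (o 0 * ι 1 - o 1 * ι 0 + 1) * hdyad
  have hoo : ∑ A, ∑ B, o A * o B * K A B = 0 := by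
    simp only [hK, Fin.sum_univ_two, ho0, ho1, hi0, hi1]; ring
  have hιι : ∑ A, ∑ B, ι A * ι B * K A B = k₂ := by
    simp only [hK, Fin.sum_univ_two, ho0, ho1, hi0, hi1]
    linear_combination k₂ * (o 0 * ι 1 - o 1 * ι 0 + 1) * hdyad
  clear_value r
  have hD10 : ∀ A, D A 1 0 = D A 0 1 := fun A ↦ hsymm A 1 0
  have hK10 : K 1 0 = K 0 1 := by rw [hK, hK]; ring
  have k00 := hkil 0 0
  have k01 := hkil 0 1
  have k11 := hkil 1 1
  clear hkil hsymm hD hK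
  simp only [Fin.sum_univ_two, hD10, hK10] at k00 k01 k11 h1 h2 hoι hoo hιι hφ
  have hGo : ∑ B, o B * (3 * (dφ 1 * K 0 B - dφ 0 * K 1 B) + φ * (D 1 0 B - D 0 1 B)) = 0 := by
    simp only [Fin.sum_univ_two, hD10, hK10]
    linear_combination - (o 0 * (3 * (dφ 1 * K 0 0 - dφ 0 * K 0 1) + φ * (D 1 0 0 - D 0 0 1))
      + o 1 * (3 * (dφ 1 * K 0 1 - dφ 0 * K 1 1) + φ * (D 1 0 1 - D 0 1 1))) * hdyad
      + 3 * (ι 0 * dφ 0 + ι 1 * dφ 1) * hoo - 3 * (o 0 * dφ 0 + o 1 * dφ 1) * hoι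
      + φ * (3 / 2) * h1 + 3 * k₁ * hφ
      - φ / 2 * (o 0 * ι 0 * k00 + (o 0 * ι 1 + o 1 * ι 0) * k01 + o 1 * ι 1 * k11)
  have hGι : ∑ B, ι B * (3 * (dφ 1 * K 0 B - dφ 0 * K 1 B) + φ * (D 1 0 B - D 0 1 B)) = 0 := by
    simp only [Fin.sum_univ_two, hD10, hK10]
    linear_combination - (ι 0 * (3 * (dφ 1 * K 0 0 - dφ 0 * K 0 1) + φ * (D 1 0 0 - D 0 0 1))
      + ι 1 * (3 * (dφ 1 * K 0 1 - dφ 0 * K 1 1) + φ * (D 1 0 1 - D 0 1 1))) * hdyad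
      + 3 * (ι 0 * dφ 0 + ι 1 * dφ 1) * hoι - 3 * (o 0 * dφ 0 + o 1 * dφ 1) * hιι
      + 3 * φ * h2 + 3 * k₂ * hφ + 3 * (ι 0 * hk 0 + ι 1 * hk 1)
      - φ * (ι 0 * ι 0 * k00 + 2 * ι 0 * ι 1 * k01 + ι 1 * ι 1 * k11)
  simp only [Fin.sum_univ_two] at hGo hGι
  fin_cases B
  · simp only [Fin.zero_eta]
    linear_combination ι 1 * hGo - o 1 * hGι - (3 * (dφ 1 * K 0 0 - dφ 0 * K 1 0)
      + φ * (D 1 0 0 - D 0 1 0)) * hdyad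
  · simp only [Fin.mk_one]
    linear_combination o 0 * hGι - ι 0 * hGo - (3 * (dφ 1 * K 0 1 - dφ 0 * K 1 1)
      + φ * (D 1 0 1 - D 0 1 1)) * hdyad

end

section

lemma lower_zero {N : Type*} (ξ : Spinor N) (x : N) : lower ξ x 0 = - ξ x 1 := by
  simp [lower, eps, Fin.sum_univ_two]

lemma lower_one {N : Type*} (ξ : Spinor N) (x : N) : lower ξ x 1 = ξ x 0 := by
  simp [lower, eps, Fin.sum_univ_two]

variable {M : Type*} [TopologicalSpace M] [ChartedSpace E4 M]
variable [IsManifold 𝓘(ℝ, E4) ω M] {g : LorentzMetric M} (S : SpinFrame g)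

lemma mdifferentiableAt_lower {ξ : Spinor M} (hξ : ∀ A, SSmooth (fun x ↦ ξ x A)) (x : M)
    (A : Fin 2) : MDifferentiableAt 𝓘(ℝ, E4) 𝓘(ℝ, ℂ) (fun y ↦ lower ξ y A) x := by
  fin_cases A
  · simpa only [Fin.zero_eta, lower_zero] using! ((hξ 1).mdifferentiableAt x).neg
  · simpa only [Fin.mk_one, lower_one] using! (hξ 0).mdifferentiableAt x

lemma mdifferentiableAt_ofComponents {o ι : Spinor M}
    (ho : ∀ A, SSmooth (fun x ↦ o x A)) (hι : ∀ A, SSmooth (fun x ↦ ι x A))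
    {K₁ K₂ : M → ℂ} (hK₁ : SSmooth K₁) (hK₂ : SSmooth K₂) (x : M) (B C : Fin 2) :
    MDifferentiableAt 𝓘(ℝ, E4) 𝓘(ℝ, ℂ) (fun y ↦ ofComponents o ι 0 K₁ K₂ y B C) x := by
  have mo := mdifferentiableAt_lower ho x
  have mι := mdifferentiableAt_lower hι x
  have e : (fun y ↦ ofComponents o ι 0 K₁ K₂ y B C) =
      fun y ↦ (K₂ y * lower o y B) * lower o y C
        + (-1 * K₁ y) * (lower o y B * lower ι y C + lower o y C * lower ι y B) := by
    funext y; simp only [ofComponents, Pi.zero_apply]; ring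
  rw [e]
  exact mdifferentiableAt_fun_add
    (mdifferentiableAt_fun_mul (mdifferentiableAt_fun_mul (hK₂.mdifferentiableAt x) (mo B)) (mo C))
    (mdifferentiableAt_fun_mul (mdifferentiableAt_fun_mul mdifferentiableAt_const
      (hK₁.mdifferentiableAt x)) (mdifferentiableAt_fun_add (mdifferentiableAt_fun_mul (mo B) (mι C))
      (mdifferentiableAt_fun_mul (mo C) (mι B))))

namespace SpinFrame

lemma nabla0_mul {f h : M → ℂ} {x : M} (hf : MDifferentiableAt 𝓘(ℝ, E4) 𝓘(ℝ, ℂ) f x)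
    (hh : MDifferentiableAt 𝓘(ℝ, E4) 𝓘(ℝ, ℂ) h x) (A A' : Fin 2) :
    S.nabla0 (fun y ↦ f y * h y) x A A' = f x * S.nabla0 h x A A' + h x * S.nabla0 f x A A' := by
  simp only [nabla0, dirC_mul _ hf hh, Finset.mul_sum, ← Finset.sum_add_distrib]
  exact Finset.sum_congr rfl fun c _ ↦ by ring

lemma nabla0_const (k : ℂ) (x : M) (A A' : Fin 2) : S.nabla0 (fun _ ↦ k) x A A' = 0 := by
  simp [nabla0]

lemma nabla2_smul {f : M → ℂ} {K : Spinor2 M} {x : M}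
    (hf : MDifferentiableAt 𝓘(ℝ, E4) 𝓘(ℝ, ℂ) f x)
    (hK : ∀ B C, MDifferentiableAt 𝓘(ℝ, E4) 𝓘(ℝ, ℂ) (fun y ↦ K y B C) x) (A A' B C : Fin 2) :
    S.nabla2 (fun y B C ↦ f y * K y B C) x A A' B C =
      S.nabla0 f x A A' * K x B C + f x * S.nabla2 K x A A' B C := by
  simp only [nabla2, nabla0, dirC_mul _ hf (hK B C), Finset.sum_mul, Finset.mul_sum,
    ← Finset.sum_add_distrib, Fin.sum_univ_two]
  exact Finset.sum_congr rfl fun c _ ↦ by ring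

lemma nabla2_tensor {ξ ζ : Spinor M} {x : M}
    (hξ : ∀ B, MDifferentiableAt 𝓘(ℝ, E4) 𝓘(ℝ, ℂ) (fun y ↦ ξ y B) x)
    (hζ : ∀ B, MDifferentiableAt 𝓘(ℝ, E4) 𝓘(ℝ, ℂ) (fun y ↦ ζ y B) x) (A A' B C : Fin 2) :
    S.nabla2 (fun y B C ↦ ξ y B * ζ y C) x A A' B C =
      S.nabla1 ξ x A A' B * ζ x C + ξ x B * S.nabla1 ζ x A A' C := by
  simp only [nabla2, nabla1, dirC_mul _ (hξ B) (hζ C), Finset.sum_mul, Finset.mul_sum,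
    ← Finset.sum_add_distrib, Fin.sum_univ_two]
  exact Finset.sum_congr rfl fun c _ ↦ by ring

lemma nabla2_add {K L : Spinor2 M} {x : M}
    (hK : ∀ B C, MDifferentiableAt 𝓘(ℝ, E4) 𝓘(ℝ, ℂ) (fun y ↦ K y B C) x)
    (hL : ∀ B C, MDifferentiableAt 𝓘(ℝ, E4) 𝓘(ℝ, ℂ) (fun y ↦ L y B C) x) (A A' B C : Fin 2) :
    S.nabla2 (fun y B C ↦ K y B C + L y B C) x A A' B C =
      S.nabla2 K x A A' B C + S.nabla2 L x A A' B C := by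
  simp only [nabla2, dirC_add _ (hK B C) (hL B C), ← Finset.sum_add_distrib, Fin.sum_univ_two]
  exact Finset.sum_congr rfl fun c _ ↦ by ring

lemma nabla2_sub {K L : Spinor2 M} {x : M}
    (hK : ∀ B C, MDifferentiableAt 𝓘(ℝ, E4) 𝓘(ℝ, ℂ) (fun y ↦ K y B C) x)
    (hL : ∀ B C, MDifferentiableAt 𝓘(ℝ, E4) 𝓘(ℝ, ℂ) (fun y ↦ L y B C) x) (A A' B C : Fin 2) :
    S.nabla2 (fun y B C ↦ K y B C - L y B C) x A A' B C =
      S.nabla2 K x A A' B C - S.nabla2 L x A A' B C := by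
  simp only [nabla2, dirC_sub _ (hK B C) (hL B C), ← Finset.sum_sub_distrib, Fin.sum_univ_two]
  exact Finset.sum_congr rfl fun c _ ↦ by ring

variable {o ι : Spinor M}

/-- Covariant derivative of `o_A ι^A = 1`. -/
lemma nabla1_dyad (ho : ∀ A, SSmooth (fun x ↦ o x A)) (hι : ∀ A, SSmooth (fun x ↦ ι x A))
    (hdyad : ∀ x, ∑ A, lower o x A * ι x A = 1) (x : M) (A A' : Fin 2) :
    ι x 0 * S.nabla1 (lower o) x A A' 0 + ι x 1 * S.nabla1 (lower o) x A A' 1 =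
      o x 0 * S.nabla1 (lower ι) x A A' 0 + o x 1 * S.nabla1 (lower ι) x A A' 1 := by
  have hd : ∀ y, lower o y 0 * lower ι y 1 - lower o y 1 * lower ι y 0 = 1 := by
    intro y
    rw [← hdyad y, Fin.sum_univ_two, lower_zero ι, lower_one ι]; ring
  have mo := mdifferentiableAt_lower ho x
  have mι := mdifferentiableAt_lower hι x
  have h : ∀ c, lower o x 0 * dirC (S.vec c) (fun y ↦ lower ι y 1) x
      + lower ι x 1 * dirC (S.vec c) (fun y ↦ lower o y 0) x
      - (lower o x 1 * dirC (S.vec c) (fun y ↦ lower ι y 0) x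
      + lower ι x 0 * dirC (S.vec c) (fun y ↦ lower o y 1) x) = 0 := by
    intro c
    rw [← dirC_mul _ (mo 0) (mι 1), ← dirC_mul _ (mo 1) (mι 0),
      ← dirC_sub _ (mdifferentiableAt_fun_mul (mo 0) (mι 1))
        (mdifferentiableAt_fun_mul (mo 1) (mι 0))]
    simp only [hd, dirC_const]
  rw [← sub_eq_zero]
  simp only [nabla1, Fin.sum_univ_four, Fin.sum_univ_two]
  simp only [lower_zero, lower_one] at h ⊢
  have t := fun c ↦ S.spinConn_trace c x
  linear_combination ivdw 0 A A' * (h 0 + (ι x 0 * o x 1 - ι x 1 * o x 0) * t 0)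
    + ivdw 1 A A' * (h 1 + (ι x 0 * o x 1 - ι x 1 * o x 0) * t 1)
    + ivdw 2 A A' * (h 2 + (ι x 0 * o x 1 - ι x 1 * o x 0) * t 2)
    + ivdw 3 A A' * (h 3 + (ι x 0 * o x 1 - ι x 1 * o x 0) * t 3)

/-- Covariant derivative of `K₂ o_A o_B - 2 K₁ o_{(A} ι_{B)}`. -/
lemma nabla2_ofComponents (ho : ∀ A, SSmooth (fun x ↦ o x A)) (hι : ∀ A, SSmooth (fun x ↦ ι x A))
    {K₁ K₂ : M → ℂ} (hK₁ : SSmooth K₁) (hK₂ : SSmooth K₂) (x : M) (A A' B C : Fin 2) :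
    S.nabla2 (ofComponents o ι 0 K₁ K₂) x A A' B C =
      S.nabla0 K₂ x A A' * lower o x B * lower o x C
      + K₂ x * (S.nabla1 (lower o) x A A' B * lower o x C
        + lower o x B * S.nabla1 (lower o) x A A' C)
      - S.nabla0 K₁ x A A' * (lower o x B * lower ι x C + lower o x C * lower ι x B)
      - K₁ x * (S.nabla1 (lower o) x A A' B * lower ι x C
        + lower o x B * S.nabla1 (lower ι) x A A' C
        + S.nabla1 (lower o) x A A' C * lower ι x B
        + lower o x C * S.nabla1 (lower ι) x A A' B) := by
  have mo := mdifferentiableAt_lower ho x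
  have mι := mdifferentiableAt_lower hι x
  have m1 := hK₁.mdifferentiableAt x
  have m2 := hK₂.mdifferentiableAt x
  have e : ofComponents o ι 0 K₁ K₂ = fun y B C ↦ K₂ y * (lower o y B * lower o y C)
      - K₁ y * (lower o y B * lower ι y C + lower ι y B * lower o y C) := by
    funext y B C
    simp only [ofComponents, Pi.zero_apply]
    ring
  have moo := fun B C ↦ mdifferentiableAt_fun_mul (mo B) (mo C)
  have moι := fun B C ↦ mdifferentiableAt_fun_mul (mo B) (mι C)
  have mιo := fun B C ↦ mdifferentiableAt_fun_mul (mι B) (mo C)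
  have ms := fun B C ↦ mdifferentiableAt_fun_add (moι B C) (mιo B C)
  rw [e, S.nabla2_sub (K := fun y B C ↦ K₂ y * (lower o y B * lower o y C))
      (L := fun y B C ↦ K₁ y * (lower o y B * lower ι y C + lower ι y B * lower o y C))
      (fun B C ↦ mdifferentiableAt_fun_mul m2 (moo B C))
      (fun B C ↦ mdifferentiableAt_fun_mul m1 (ms B C)),
    S.nabla2_smul (K := fun y B C ↦ lower o y B * lower o y C) m2 moo,
    S.nabla2_smul (K := fun y B C ↦ lower o y B * lower ι y C + lower ι y B * lower o y C) m1 ms,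
    S.nabla2_add (K := fun y B C ↦ lower o y B * lower ι y C)
      (L := fun y B C ↦ lower ι y B * lower o y C) moι mιo,
    S.nabla2_tensor mo mo, S.nabla2_tensor mo mι, S.nabla2_tensor mι mo]
  ring

/-- `o^A f_{AA'} = ι^A o^B ∇_{AA'} o_B`. -/
lemma contract_fForm (hdyad : ∀ x, ∑ A, lower o x A * ι x A = 1) (x : M) (A' : Fin 2) :
    ∑ A, o x A * S.fForm o ι x A A' =
      ∑ A, ∑ B, ι x A * o x B * S.nabla1 (lower o) x A A' B := by
  have hd := hdyad x
  simp only [Fin.sum_univ_two, lower_zero, lower_one] at hd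
  have hdc := congrArg (starRingEnd ℂ) hd
  simp only [map_add, map_mul, map_neg, map_one] at hdc
  have e : ∑ A, o x A * S.fForm o ι x A A' =
      - S.rho o ι x * starRingEnd ℂ (lower ι x A') + S.tau o ι x * starRingEnd ℂ (lower o x A') := by
    simp only [fForm, covec, Fin.sum_univ_two, lower_zero, lower_one, cc]
    linear_combination (- S.rho o ι x * starRingEnd ℂ (lower ι x A')
      + S.tau o ι x * starRingEnd ℂ (lower o x A')) * hd
  rw [e]
  have key : ∀ B' : Fin 2, starRingEnd ℂ (lower o x A') * starRingEnd ℂ (ι x B')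
      - starRingEnd ℂ (lower ι x A') * starRingEnd ℂ (o x B') = if A' = B' then 1 else 0 := by
    intro B'
    fin_cases A' <;> fin_cases B' <;> simp [lower_zero, lower_one] <;>
      first | ring1 | linear_combination hdc
  have h0 := key 0
  have h1 := key 1
  simp only [rho, tau, coef, Fin.sum_univ_two, cc]
  fin_cases A' <;> simp at h0 h1 ⊢
  all_goals
    linear_combination
      (ι x 0 * o x 0 * S.nabla1 (lower o) x 0 0 0 + ι x 0 * o x 1 * S.nabla1 (lower o) x 0 0 1
      + ι x 1 * o x 0 * S.nabla1 (lower o) x 1 0 0 + ι x 1 * o x 1 * S.nabla1 (lower o) x 1 0 1) * h0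
      + (ι x 0 * o x 0 * S.nabla1 (lower o) x 0 1 0 + ι x 0 * o x 1 * S.nabla1 (lower o) x 0 1 1
      + ι x 1 * o x 0 * S.nabla1 (lower o) x 1 1 0 + ι x 1 * o x 1 * S.nabla1 (lower o) x 1 1 1) * h1

lemma maxwell_of_projectedKilling
    (ho : ∀ A, SSmooth (fun x ↦ o x A)) (hι : ∀ A, SSmooth (fun x ↦ ι x A))
    (hdyad : ∀ x, ∑ A, lower o x A * ι x A = 1)
    {φ η K₁ K₂ : M → ℂ} (hφ : SSmooth φ) (hf : S.IsDecomposition o ι φ η)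
    (hK₁ : SSmooth K₁) (hK₂ : SSmooth K₂)
    (hK : S.IsProjectedKilling o (ofComponents o ι 0 K₁ K₂))
    {c : ℂ} (hc : ∀ x, K₁ x = c * (φ x)⁻¹) :
    S.IsMaxwell (fun x A B ↦ -2 * φ x ^ 3 * ofComponents o ι 0 K₁ K₂ x A B) := by
  have hKsymm : ∀ x A B, ofComponents o ι 0 K₁ K₂ x A B = ofComponents o ι 0 K₁ K₂ x B A := by
    intro x A B; simp only [ofComponents]; ring
  refine ⟨fun x A B ↦ by simp only [hKsymm x A B], fun x A' B ↦ ?_⟩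
  have mφ := hφ.mdifferentiableAt x
  have mK := mdifferentiableAt_ofComponents ho hι hK₁ hK₂ x
  have e3 : (fun y ↦ -2 * φ y ^ 3) = fun y ↦ -2 * (φ y * (φ y * φ y)) := by funext y; ring
  have m2 := mdifferentiableAt_fun_mul mφ mφ
  have m3 := mdifferentiableAt_fun_mul mφ m2
  have d3 : ∀ A A', S.nabla0 (fun y ↦ -2 * φ y ^ 3) x A A' = -6 * φ x ^ 2 * S.nabla0 φ x A A' := by
    intro A A'
    rw [e3, S.nabla0_mul mdifferentiableAt_const m3, S.nabla0_mul mφ m2, S.nabla0_mul mφ mφ,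
      nabla0_const]
    ring
  have mφ3 : MDifferentiableAt 𝓘(ℝ, E4) 𝓘(ℝ, ℂ) (fun y ↦ -2 * φ y ^ 3) x := by
    rw [e3]; exact mdifferentiableAt_fun_mul mdifferentiableAt_const m3
  have dK₁ : ∀ A A', S.nabla0 K₁ x A A' * φ x + K₁ x * S.nabla0 φ x A A' = 0 := by
    intro A A'
    have e : (fun y ↦ K₁ y * φ y) = fun _ ↦ c := by
      funext y; rw [hc, mul_assoc, inv_mul_cancel₀ (hf.1 y), mul_one]
    have h := S.nabla0_mul (hK₁.mdifferentiableAt x) mφ A A'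
    rw [e, nabla0_const] at h
    linear_combination -h
  have key : ∀ A', 3 * (S.nabla0 φ x 1 A' * ofComponents o ι 0 K₁ K₂ x 0 B
        - S.nabla0 φ x 0 A' * ofComponents o ι 0 K₁ K₂ x 1 B)
      + φ x * (S.nabla2 (ofComponents o ι 0 K₁ K₂) x 1 A' 0 B
        - S.nabla2 (ofComponents o ι 0 K₁ K₂) x 0 A' 1 B) = 0 := by
    intro A'
    refine maxwell_of_killing_algebra (o x) (ι x) (fun A B ↦ S.nabla1 (lower o) x A A' B)
      (fun A B ↦ S.nabla1 (lower ι) x A A' B) (fun A ↦ S.nabla0 K₁ x A A')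
      (fun A ↦ S.nabla0 K₂ x A A') (fun A ↦ S.nabla0 φ x A A') (K₁ x) (K₂ x) (φ x)
      (fun A B C ↦ S.nabla2 (ofComponents o ι 0 K₁ K₂) x A A' B C) (ofComponents o ι 0 K₁ K₂ x)
      (lower o x) (lower ι x) (lower_zero o x) (lower_one o x) (lower_zero ι x) (lower_one ι x)
      ?_ (fun A ↦ S.nabla1_dyad ho hι hdyad x A A') ?_
      (fun A B C ↦ S.nabla2_ofComponents ho hι hK₁ hK₂ x A A' B C) ?_ ?_ (fun A ↦ dK₁ A A') B
    · have hd := hdyad x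
      simp only [Fin.sum_univ_two, lower_zero, lower_one] at hd
      linear_combination hd
    · intro B C; simp only [ofComponents, Pi.zero_apply]; ring
    · rw [← S.contract_fForm hdyad x A']
      simp only [hf.2, Fin.sum_univ_two, lower_zero, lower_one]
      field_simp [hf.1 x]
      ring
    · intro B C
      have h := hK x A' B C
      have hs : ∀ A B C, S.nabla2 (ofComponents o ι 0 K₁ K₂) x A A' B C =
          S.nabla2 (ofComponents o ι 0 K₁ K₂) x A A' C B := by
        intro A B C
        rw [S.nabla2_ofComponents ho hι hK₁ hK₂, S.nabla2_ofComponents ho hι hK₁ hK₂]; ring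
      simp only [symmetrize_three, Matrix.cons_val_zero, Matrix.cons_val_one, Matrix.cons_val,
        Fin.sum_univ_two] at h ⊢
      rw [hs 0 C B, hs 1 C B, hs B C 0, hs B C 1, hs C B 0, hs C B 1] at h
      linear_combination 3 * h
  have h0 := key 0
  have h1 := key 1
  simp only [S.nabla2_smul (f := fun y ↦ -2 * φ y ^ 3) mφ3 mK, d3]
  fin_cases A'
  · simp [Fin.sum_univ_two, eps]
    linear_combination (-2 * φ x ^ 2) * h1
  · simp [Fin.sum_univ_two, eps]
    linear_combination (2 * φ x ^ 2) * h0

end SpinFrame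

end

section

variable {M : Type*} [TopologicalSpace M] [ChartedSpace E4 M]
lemma VSmooth.mdifferentiableAt {n : WithTop ℕ∞} [IsManifold 𝓘(ℝ, E4) 1 M] (hn : n ≠ 0)
    {X : VField M} (hX : VSmooth n X) (x : M) :
    MDifferentiableAt 𝓘(ℝ, E4) (𝓘(ℝ, E4).prod 𝓘(ℝ, E4))
      (fun x ↦ Bundle.TotalSpace.mk' E4 (E := TangentSpace 𝓘(ℝ, E4)) x (X x)) x :=
  ContMDiff.mdifferentiableAt hX hn

variable [IsManifold 𝓘(ℝ, E4) ω M] {g : LorentzMetric M} (S : SpinFrame g)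

lemma LorentzMetric.mdifferentiableAt_app (g : LorentzMetric M) {X Y : VField M}
    (hX : VSmooth ∞ X) (hY : VSmooth ∞ Y) (x : M) :
    MDifferentiableAt 𝓘(ℝ, E4) 𝓘(ℝ, ℝ) (g.app X Y) x := by
  have h : ContMDiff 𝓘(ℝ, E4) (𝓘(ℝ, E4).prod 𝓘(ℝ, ℝ)) ∞
      (fun m ↦ Bundle.TotalSpace.mk' ℝ (E := Bundle.Trivial M ℝ) m (g.inner m (X m) (Y m))) :=
    ContMDiff.clm_bundle_apply₂ (F₁ := E4) (F₂ := E4) (F₃ := ℝ)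
      (E₁ := TangentSpace 𝓘(ℝ, E4)) (E₂ := TangentSpace 𝓘(ℝ, E4)) (E₃ := Bundle.Trivial M ℝ)
      (b := id) (g.contMDiff.of_le le_top) hX hY
  have h2 : ContMDiff 𝓘(ℝ, E4) 𝓘(ℝ, ℝ) ∞ (g.app X Y) := by
    intro x
    exact (Bundle.contMDiffAt_section _).1 (h x)
  exact h2.mdifferentiableAt (by simp)

lemma mlieBracket_smul_sum_right (X : VField M) {f : Fin 4 → M → ℝ} {e : Fin 4 → VField M} {x : M}
    (hf : ∀ b, MDifferentiableAt 𝓘(ℝ, E4) 𝓘(ℝ, ℝ) (f b) x)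
    (he : ∀ b, MDifferentiableAt 𝓘(ℝ, E4) (𝓘(ℝ, E4).prod 𝓘(ℝ, E4))
      (fun x ↦ Bundle.TotalSpace.mk' E4 (E := TangentSpace 𝓘(ℝ, E4)) x (e b x)) x) :
    bracket X (fun y ↦ ∑ b, f b y • e b y) x =
      ∑ b, (dirR X (f b) x • e b x + f b x • bracket X (e b) x) := by
  have : IsManifold 𝓘(ℝ, E4) 2 M := IsManifold.of_le (n := ω) le_top
  have hfe : ∀ b, MDifferentiableAt 𝓘(ℝ, E4) (𝓘(ℝ, E4).prod 𝓘(ℝ, E4))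
      (fun x ↦ Bundle.TotalSpace.mk' E4 (E := TangentSpace 𝓘(ℝ, E4)) x ((f b • e b) x)) x :=
    fun b ↦ (hf b).smul_section (he b)
  have hs : (fun y ↦ ∑ b, f b y • e b y) = ((f 0 • e 0 + f 1 • e 1) + f 2 • e 2) + f 3 • e 3 := by
    funext y; simp [Fin.sum_univ_four]
  have h01 := mdifferentiableAt_add_section (hfe 0) (hfe 1)
  have h012 := mdifferentiableAt_add_section h01 (hfe 2)
  rw [hs, bracket, VectorField.mlieBracket_add_right h012 (hfe 3),
    VectorField.mlieBracket_add_right h01 (hfe 2),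
    VectorField.mlieBracket_add_right (hfe 0) (hfe 1), Fin.sum_univ_four]
  simp only [VectorField.mlieBracket_smul_right (hf _) (he _)]
  rfl

namespace SpinFrame

/-- The component `X^a` of a vector field in the tetrad. -/
def comp (X : VField M) (a : Fin 4) (x : M) : ℝ := mink a * g.app X (S.vec a) x

lemma sum_comp (X : VField M) (x : M) : X x = ∑ a, S.comp X a x • S.vec a x := by
  have hne : ∀ a, mink a ≠ 0 := fun a h0 ↦ by simpa [h0] using mink_mul_self a
  have hin : ∀ (r : Fin 4 → ℝ) (b : Fin 4),
      g.inner x (∑ a, r a • S.vec a x) (S.vec b x) = r b * mink b := by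
    intro r b
    rw [map_sum, sum_apply]
    simp only [map_smul, smul_apply, S.orthonormal, smul_eq_mul]
    simp
  have hli : LinearIndependent ℝ (fun a ↦ S.vec a x) := by
    rw [Fintype.linearIndependent_iff]
    intro r hr b
    have h := hin r b
    rw [hr] at h
    simpa [hne b] using h.symm
  have hsp : X x ∈ Submodule.span ℝ (Set.range fun a ↦ S.vec a x) := by
    rw [hli.span_eq_top_of_card_eq_finrank (by
      change _ = Module.finrank ℝ E4
      simp)]
    trivial
  obtain ⟨r, hr⟩ := (Submodule.mem_span_range_iff_exists_fun ℝ).1 hsp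
  rw [← hr]
  refine Finset.sum_congr rfl fun a _ ↦ ?_
  have : S.comp X a x = r a := by
    simp only [comp, LorentzMetric.app]
    rw [← hr, hin]
    linear_combination r a * mink_mul_self a
  rw [this]

lemma vSmooth_vec (a : Fin 4) : VSmooth ∞ (S.vec a) := (S.analytic a).of_le le_top

lemma mdifferentiableAt_comp {X : VField M} (hX : VSmooth ∞ X) (a : Fin 4) (x : M) :
    MDifferentiableAt 𝓘(ℝ, E4) 𝓘(ℝ, ℝ) (S.comp X a) x :=
  (mdifferentiableAt_const (c := mink a)).mul (g.mdifferentiableAt_app hX (S.vSmooth_vec a) x)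

lemma dirC_eq_sum (X : VField M) (f : M → ℂ) (x : M) :
    dirC X f x = ∑ a, (S.comp X a x : ℂ) * dirC (S.vec a) f x := by
  have h := congrArg (mfderiv 𝓘(ℝ, E4) 𝓘(ℝ, ℂ) f x) (S.sum_comp X x)
  rw [map_sum] at h
  simp only [map_smul] at h
  exact h.trans (Finset.sum_congr rfl fun a _ ↦ Complex.real_smul)

lemma dirR_eq_sum (X : VField M) (f : M → ℝ) (x : M) :
    dirR X f x = ∑ a, S.comp X a x * dirR (S.vec a) f x := by
  have h := congrArg (mfderiv 𝓘(ℝ, E4) 𝓘(ℝ, ℝ) f x) (S.sum_comp X x)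
  rw [map_sum] at h
  simp only [map_smul] at h
  exact h

/-- Components of a Lie bracket in the tetrad. -/
lemma comp_bracket {X Y : VField M} (hX : VSmooth ∞ X) (hY : VSmooth ∞ Y) (d : Fin 4) (x : M) :
    S.comp (bracket X Y) d x = dirR X (S.comp Y d) x - dirR Y (S.comp X d) x
      + ∑ a, ∑ b, S.comp X a x * S.comp Y b x * S.struct a b d x := by
  have mv := fun b ↦ (S.vSmooth_vec b).mdifferentiableAt (by simp) x
  have key : ∀ (Z : VField M) {W : VField M}, VSmooth ∞ W → S.comp (bracket Z W) d x =
      dirR Z (S.comp W d) x + ∑ b, S.comp W b x * S.comp (bracket Z (S.vec b)) d x := by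
    intro Z W hW
    have h := mlieBracket_smul_sum_right Z (fun b ↦ S.mdifferentiableAt_comp hW b x) mv
    rw [← funext (S.sum_comp W)] at h
    simp only [comp, LorentzMetric.app] at h ⊢
    rw [h, map_sum, sum_apply]
    simp only [map_add, map_smul, add_apply, smul_apply,
      S.orthonormal, smul_eq_mul, Finset.sum_add_distrib]
    simp only [mul_ite, mul_zero, Finset.sum_ite_eq', Finset.mem_univ, if_true, mul_add]
    have hm : mink d * (dirR Z (S.comp W d) x * mink d) = dirR Z (S.comp W d) x := by
      linear_combination dirR Z (S.comp W d) x * mink_mul_self d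
    rw [hm, Finset.mul_sum]
    exact congrArg _ (Finset.sum_congr rfl fun b _ ↦ by ring)
  have hswap : ∀ (Z W : VField M), S.comp (bracket Z W) d x = - S.comp (bracket W Z) d x := by
    intro Z W; simp only [comp]; rw [app_bracket_swap]; ring
  rw [key X hY]
  simp only [fun b ↦ hswap X (S.vec b), key (S.vec _) hX, S.dirR_eq_sum Y]
  have hst : ∀ a b, S.struct a b d x = - S.comp (bracket (S.vec b) (S.vec a)) d x := by
    intro a b; rw [← hswap]; rfl
  simp only [hst, mul_neg, mul_add, Finset.mul_sum, Finset.sum_neg_distrib, Finset.sum_add_distrib]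
  rw [Finset.sum_comm (f := fun a b ↦ S.comp X a x * S.comp Y b x
    * S.comp (bracket (S.vec b) (S.vec a)) d x)]
  simp only [mul_left_comm (S.comp Y _ x), ← mul_assoc]
  ring

end SpinFrame

end

section

variable {M : Type*} [TopologicalSpace M] [ChartedSpace E4 M]

/-- Tetrad components of `Ψ_{AB} ε̄_{A'B'}`. -/
def fcomp (Ψ : Fin 2 → Fin 2 → ℂ) (a b : Fin 4) : ℂ :=
  ∑ A, ∑ A', ∑ B, ∑ B', ivdwInv a A A' * ivdwInv b B B' * Ψ A B * eps A' B'

lemma fcomp_eq (Ψ : Fin 2 → Fin 2 → ℂ) (hΨ : Ψ 1 0 = Ψ 0 1) (a b : Fin 4) :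
    fcomp Ψ a b =
      (!![0, (Ψ 0 0 - Ψ 1 1) / 2, Complex.I * (Ψ 0 0 + Ψ 1 1) / 2, - Ψ 0 1;
        - (Ψ 0 0 - Ψ 1 1) / 2, 0, Complex.I * Ψ 0 1, - (Ψ 0 0 + Ψ 1 1) / 2;
        - Complex.I * (Ψ 0 0 + Ψ 1 1) / 2, - Complex.I * Ψ 0 1, 0,
          - Complex.I * (Ψ 0 0 - Ψ 1 1) / 2;
        Ψ 0 1, (Ψ 0 0 + Ψ 1 1) / 2, Complex.I * (Ψ 0 0 - Ψ 1 1) / 2, 0] :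
        Matrix (Fin 4) (Fin 4) ℂ) a b := by
  have h := inv_sqrt_two_sq
  have hI := Complex.I_mul_I
  generalize hs : ((Real.sqrt 2 : ℝ) : ℂ)⁻¹ = s at h
  have hc : starRingEnd ℂ s = s := by rw [← hs, map_inv₀, Complex.conj_ofReal]
  fin_cases a <;> fin_cases b <;>
    simp [fcomp, ivdwInv, ivdw, eps, Fin.sum_univ_two, hs, hc, hΨ] <;> grind

lemma fcomp_antisymm {Ψ : Fin 2 → Fin 2 → ℂ} (hΨ : Ψ 1 0 = Ψ 0 1) (a b : Fin 4) :
    fcomp Ψ a b = - fcomp Ψ b a := by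
  rw [fcomp_eq Ψ hΨ, fcomp_eq Ψ hΨ]
  fin_cases a <;> fin_cases b <;> simp <;> ring

/-- The spinor connection coefficients, as a combination of conjugate Pauli matrices. -/
lemma spinConn_table (Γ : Fin 4 → Fin 4 → ℂ) (hΓ : ∀ a b, (mink a : ℂ) * Γ a b = - (mink b * Γ b a))
    (A B : Fin 2) :
    (1 / 2) * ∑ a, ∑ b, ∑ A', ivdwInv a A A' * Γ a b * ivdw b B A' =
      (!![Γ 0 3 - Complex.I * Γ 1 2,
          Γ 0 1 - Complex.I * Γ 2 3 + Complex.I * (Γ 0 2 - Complex.I * Γ 3 1);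
        Γ 0 1 - Complex.I * Γ 2 3 - Complex.I * (Γ 0 2 - Complex.I * Γ 3 1),
          - (Γ 0 3 - Complex.I * Γ 1 2)] : Matrix (Fin 2) (Fin 2) ℂ) A B / 2 := by
  have h := inv_sqrt_two_sq
  have hI := Complex.I_mul_I
  generalize hs : ((Real.sqrt 2 : ℝ) : ℂ)⁻¹ = s at h
  have hc : starRingEnd ℂ s = s := by rw [← hs, map_inv₀, Complex.conj_ofReal]
  have h00 := hΓ 0 0
  have h11 := hΓ 1 1
  have h22 := hΓ 2 2
  have h33 := hΓ 3 3
  have h01 := hΓ 0 1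
  have h02 := hΓ 0 2
  have h03 := hΓ 0 3
  have h12 := hΓ 1 2
  have h23 := hΓ 2 3
  have h31 := hΓ 3 1
  simp [mink] at h00 h11 h22 h33 h01 h02 h03 h12 h23 h31
  fin_cases A <;> fin_cases B <;>
    simp [ivdwInv, ivdw, Fin.sum_univ_two, Fin.sum_univ_four, hs, hc] <;> grind

/-- Covariant constancy of the Infeld-van der Waerden symbols, for the two-form `Ψ_{AB} ε̄_{A'B'}`:
`G` is a derivative of `Ψ`. -/
lemma fcomp_covariant (Γ : Fin 4 → Fin 4 → ℂ)
    (hΓ : ∀ a b, (mink a : ℂ) * Γ a b = - (mink b * Γ b a)) (γ : Fin 2 → Fin 2 → ℂ)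
    (hγ : ∀ A B, γ A B = (1 / 2) * ∑ a, ∑ b, ∑ A', ivdwInv a A A' * Γ a b * ivdw b B A')
    (Ψ G : Fin 2 → Fin 2 → ℂ) (hΨ : Ψ 1 0 = Ψ 0 1) (hG : G 1 0 = G 0 1) (b c : Fin 4) :
    fcomp G b c - ∑ d, Γ d b * fcomp Ψ d c - ∑ d, Γ d c * fcomp Ψ b d =
      fcomp (fun A B ↦ G A B - ∑ D, γ D A * Ψ D B - ∑ D, γ D B * Ψ A D) b c := by
  have hN : G 1 0 - ∑ D, γ D 1 * Ψ D 0 - ∑ D, γ D 0 * Ψ 1 D =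
      G 0 1 - ∑ D, γ D 0 * Ψ D 1 - ∑ D, γ D 1 * Ψ 0 D := by
    simp only [Fin.sum_univ_two, hΨ, hG]; ring
  have hI := Complex.I_mul_I
  rw [fcomp_eq G hG, fcomp_eq _ hN]
  simp only [spinConn_table Γ hΓ] at hγ
  simp only [fcomp_eq Ψ hΨ, Fin.sum_univ_two, Fin.sum_univ_four, hγ, hΨ]
  have h00 := hΓ 0 0
  have h11 := hΓ 1 1
  have h22 := hΓ 2 2
  have h33 := hΓ 3 3
  have h01 := hΓ 0 1
  have h02 := hΓ 0 2
  have h03 := hΓ 0 3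
  have h12 := hΓ 1 2
  have h23 := hΓ 2 3
  have h31 := hΓ 3 1
  simp [mink] at h00 h11 h22 h33 h01 h02 h03 h12 h23 h31
  clear hΓ hγ hN
  fin_cases b <;> fin_cases c <;> simp <;> grind

lemma eq_zero_of_alternating (T : Fin 4 → Fin 4 → Fin 4 → ℂ) (hc : ∀ a b c, T a b c = T b c a)
    (hs : ∀ a b c, T a b c = - T b a c) (h012 : T 0 1 2 = 0) (h013 : T 0 1 3 = 0)
    (h023 : T 0 2 3 = 0) (h123 : T 1 2 3 = 0) (a b c : Fin 4) : T a b c = 0 := by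
  have h1 : ∀ a c, T a a c = 0 := fun a c ↦ self_eq_neg.mp (hs a a c)
  have h2 : ∀ a c, T a c c = 0 := fun a c ↦ by rw [hc, h1]
  have h3 : ∀ a c, T a c a = 0 := fun a c ↦ by rw [hc, h2]
  have perm : ∀ {a b c}, T a b c = 0 →
      T b a c = 0 ∧ T b c a = 0 ∧ T c a b = 0 ∧ T a c b = 0 ∧ T c b a = 0 := by
    intro a b c h
    have hba : T b a c = 0 := by rw [hs, h, neg_zero]
    exact ⟨hba, by rw [← hc, h], by rw [hc, h], by rw [← hc, hba], by rw [hc, hba]⟩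
  have p012 := perm h012
  have p013 := perm h013
  have p023 := perm h023
  have p123 := perm h123
  clear hc hs perm
  fin_cases a <;> fin_cases b <;> fin_cases c <;> simp [*]

lemma fcomp_mdifferentiableAt {Φ : Spinor2 M} {x : M}
    (hΦ : ∀ A B, MDifferentiableAt 𝓘(ℝ, E4) 𝓘(ℝ, ℂ) (fun y ↦ Φ y A B) x) (a b : Fin 4) :
    MDifferentiableAt 𝓘(ℝ, E4) 𝓘(ℝ, ℂ) (fun y ↦ fcomp (Φ y) a b) x :=
  mdifferentiableAt_finset_sum _ fun A ↦ mdifferentiableAt_finset_sum _ fun _ ↦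
    mdifferentiableAt_finset_sum _ fun B ↦ mdifferentiableAt_finset_sum _ fun _ ↦
    mdifferentiableAt_fun_mul (mdifferentiableAt_fun_mul mdifferentiableAt_const (hΦ A B))
      mdifferentiableAt_const

lemma dirC_fcomp (X : VField M) {Φ : Spinor2 M} {x : M}
    (hΦ : ∀ A B, MDifferentiableAt 𝓘(ℝ, E4) 𝓘(ℝ, ℂ) (fun y ↦ Φ y A B) x) (a b : Fin 4) :
    dirC X (fun y ↦ fcomp (Φ y) a b) x = fcomp (fun A B ↦ dirC X (fun y ↦ Φ y A B) x) a b := by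
  have m : ∀ A A' B B', MDifferentiableAt 𝓘(ℝ, E4) 𝓘(ℝ, ℂ)
      (fun y ↦ ivdwInv a A A' * ivdwInv b B B' * Φ y A B * eps A' B') x := fun A A' B B' ↦
    mdifferentiableAt_fun_mul (mdifferentiableAt_fun_mul mdifferentiableAt_const (hΦ A B))
      mdifferentiableAt_const
  have m1 := fun A A' B ↦ mdifferentiableAt_finset_sum Finset.univ (m A A' B)
  have m2 := fun A A' ↦ mdifferentiableAt_finset_sum Finset.univ (m1 A A')
  have m3 := fun A ↦ mdifferentiableAt_finset_sum Finset.univ (m2 A)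
  simp only [fcomp]
  rw [dirC_sum X _ m3]
  refine Finset.sum_congr rfl fun A _ ↦ ?_
  rw [dirC_sum X _ (m2 A)]
  refine Finset.sum_congr rfl fun A' _ ↦ ?_
  rw [dirC_sum X _ (m1 A A')]
  refine Finset.sum_congr rfl fun B _ ↦ ?_
  rw [dirC_sum X _ (m A A' B)]
  refine Finset.sum_congr rfl fun B' _ ↦ ?_
  rw [dirC_mul X (mdifferentiableAt_fun_mul mdifferentiableAt_const (hΦ A B))
    mdifferentiableAt_const, dirC_mul X mdifferentiableAt_const (hΦ A B), dirC_const, dirC_const]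
  ring

/-- The Maxwell equations, in terms of derivatives `N c` along the tetrad, imply `∇_[a F_bc] = 0`. -/
lemma fcomp_cyclic (N : Fin 4 → Fin 2 → Fin 2 → ℂ) (hN : ∀ c, N c 1 0 = N c 0 1)
    (hM : ∀ A' B, ∑ A, ∑ C, ∑ C', eps A C * eps A' C' * ∑ c, ivdw c C C' * N c A B = 0)
    (a b c : Fin 4) : fcomp (N a) b c + fcomp (N b) c a + fcomp (N c) a b = 0 := by
  have m00 := hM 0 0
  have m01 := hM 0 1
  have m10 := hM 1 0
  have m11 := hM 1 1
  have h := inv_sqrt_two_sq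
  have hI := Complex.I_mul_I
  generalize hs : ((Real.sqrt 2 : ℝ) : ℂ)⁻¹ = s at h
  simp [ivdw, eps, Fin.sum_univ_two, Fin.sum_univ_four, hs, hN] at m00 m01 m10 m11
  have e1 : N 0 0 0 - N 3 0 0 - N 1 0 1 + Complex.I * N 2 0 1 = 0 := by grind
  have e2 : N 0 0 1 - N 3 0 1 - N 1 1 1 + Complex.I * N 2 1 1 = 0 := by grind
  have e3 : N 1 0 0 + Complex.I * N 2 0 0 - N 0 0 1 - N 3 0 1 = 0 := by grind
  have e4 : N 1 0 1 + Complex.I * N 2 0 1 - N 0 1 1 - N 3 1 1 = 0 := by grind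
  clear m00 m01 m10 m11 h
  have anti := fun a ↦ fcomp_antisymm (hN a)
  refine eq_zero_of_alternating (fun a b c ↦ fcomp (N a) b c + fcomp (N b) c a + fcomp (N c) a b)
    (fun a b c ↦ by ring) (fun a b c ↦ ?_) ?_ ?_ ?_ ?_ a b c
  · rw [anti a b c, anti b c a, anti c a b]; ring
  all_goals
    simp only [fcomp_eq _ (hN _)]
    clear hM hN hs anti
    simp
    grind

end

section

variable {M : Type*} [TopologicalSpace M] [ChartedSpace E4 M]
variable [IsManifold 𝓘(ℝ, E4) ω M] {g : LorentzMetric M} (S : SpinFrame g)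

/-- The bilinear form with matrix `F`. -/
def pairing (F : Fin 4 → Fin 4 → ℂ) (u v : Fin 4 → ℂ) : ℂ := ∑ a, ∑ b, u a * v b * F a b

lemma pairing_swap {F : Fin 4 → Fin 4 → ℂ} (hF : ∀ a b, F a b = - F b a) (u v : Fin 4 → ℂ) :
    pairing F u v = - pairing F v u := by
  simp only [pairing]
  rw [Finset.sum_comm, ← Finset.sum_neg_distrib]
  refine Finset.sum_congr rfl fun b _ ↦ ?_
  rw [← Finset.sum_neg_distrib]
  refine Finset.sum_congr rfl fun a _ ↦ ?_
  rw [hF a b]; ring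

lemma pairing_bracket (F : Fin 4 → Fin 4 → ℂ) (u u' w v X Y : Fin 4 → ℂ)
    (s : Fin 4 → Fin 4 → Fin 4 → ℂ) (hw : ∀ d, w d = u d - u' d + ∑ a, ∑ b, X a * Y b * s a b d) :
    pairing F w v = pairing F u v - pairing F u' v
      + ∑ a, ∑ b, ∑ c, X a * Y b * v c * ∑ d, s a b d * F d c := by
  have h : ∑ a, ∑ b, ∑ c, X a * Y b * v c * ∑ d, s a b d * F d c =
      ∑ d, ∑ c, (∑ a, ∑ b, X a * Y b * s a b d) * v c * F d c := by
    simp only [Finset.sum_mul, Finset.mul_sum]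
    conv_lhs => enter [2, a, 2, b]; rw [Finset.sum_comm]
    conv_lhs => enter [2, a]; rw [Finset.sum_comm]
    rw [Finset.sum_comm]
    refine Finset.sum_congr rfl fun d _ ↦ ?_
    conv_lhs => enter [2, a]; rw [Finset.sum_comm]
    rw [Finset.sum_comm]
    refine Finset.sum_congr rfl fun c _ ↦ Finset.sum_congr rfl fun a _ ↦
      Finset.sum_congr rfl fun b _ ↦ by ring
  rw [h]
  simp only [pairing, hw, ← Finset.sum_sub_distrib, ← Finset.sum_add_distrib]
  exact Finset.sum_congr rfl fun d _ ↦ Finset.sum_congr rfl fun c _ ↦ by ring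

namespace SpinFrame

/-- Leibniz rule for the evaluation of a two-form given by its tetrad components. -/
lemma dirC_pairing {F : Fin 4 → Fin 4 → M → ℂ} {x : M}
    (hF : ∀ a b, MDifferentiableAt 𝓘(ℝ, E4) 𝓘(ℝ, ℂ) (F a b) x) (X : VField M) {Y Z : VField M}
    (hY : VSmooth ∞ Y) (hZ : VSmooth ∞ Z) :
    dirC X (fun y ↦ pairing (fun a b ↦ F a b y) (fun a ↦ (S.comp Y a y : ℂ))
        (fun a ↦ (S.comp Z a y : ℂ))) x =
      pairing (fun a b ↦ F a b x) (fun a ↦ (dirR X (S.comp Y a) x : ℂ))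
        (fun a ↦ (S.comp Z a x : ℂ))
      + pairing (fun a b ↦ F a b x) (fun a ↦ (S.comp Y a x : ℂ))
        (fun a ↦ (dirR X (S.comp Z a) x : ℂ))
      + ∑ a, ∑ b, ∑ c, (S.comp X a x : ℂ) * S.comp Y b x * S.comp Z c x
        * dirC (S.vec a) (F b c) x := by
  have mY := fun a ↦ mdifferentiableAt_ofReal (S.mdifferentiableAt_comp hY a x)
  have mZ := fun a ↦ mdifferentiableAt_ofReal (S.mdifferentiableAt_comp hZ a x)
  have mYZ := fun a b ↦ mdifferentiableAt_fun_mul (mY a) (mZ b)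
  have mYZF := fun a b ↦ mdifferentiableAt_fun_mul (mYZ a b) (hF a b)
  have h : ∑ a, ∑ b, ∑ c, (S.comp X a x : ℂ) * S.comp Y b x * S.comp Z c x
      * dirC (S.vec a) (F b c) x =
      ∑ b, ∑ c, (S.comp Y b x : ℂ) * S.comp Z c x * dirC X (F b c) x := by
    rw [Finset.sum_comm]
    refine Finset.sum_congr rfl fun b _ ↦ ?_
    rw [Finset.sum_comm]
    refine Finset.sum_congr rfl fun c _ ↦ ?_
    rw [S.dirC_eq_sum X, Finset.mul_sum]
    exact Finset.sum_congr rfl fun a _ ↦ by ring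
  rw [h]
  simp only [pairing, ← Finset.sum_add_distrib]
  rw [dirC_sum X Finset.univ (fun b ↦ mdifferentiableAt_finset_sum Finset.univ (mYZF b))]
  refine Finset.sum_congr rfl fun b _ ↦ ?_
  rw [dirC_sum X Finset.univ (mYZF b)]
  refine Finset.sum_congr rfl fun c _ ↦ ?_
  rw [dirC_mul X (mYZ b c) (hF b c), dirC_mul X (mY b) (mZ c),
    dirC_ofReal X (S.mdifferentiableAt_comp hY b x), dirC_ofReal X (S.mdifferentiableAt_comp hZ c x)]
  ring

/-- A two-form is closed if its exterior derivative vanishes on the tetrad. -/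
lemma isClosedForm_of_tetrad {F : Fin 4 → Fin 4 → M → ℂ} (hanti : ∀ a b x, F a b x = - F b a x)
    (hF : ∀ a b x, MDifferentiableAt 𝓘(ℝ, E4) 𝓘(ℝ, ℂ) (F a b) x)
    (hd : ∀ a b c x, dirC (S.vec a) (F b c) x + dirC (S.vec b) (F c a) x + dirC (S.vec c) (F a b) x
      - ∑ d, (S.struct a b d x : ℂ) * F d c x - ∑ d, (S.struct b c d x : ℂ) * F d a x
      - ∑ d, (S.struct c a d x : ℂ) * F d b x = 0) :
    IsClosedForm (fun x u v ↦ ∑ a, ∑ b, ((mink a * g.inner x u (S.vec a x) : ℝ) : ℂ) *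
      ((mink b * g.inner x v (S.vec b x) : ℝ) : ℂ) * F a b x) := by
  intro X Y Z hX hY hZ x
  change dirC X (fun y ↦ pairing (fun a b ↦ F a b y) (fun a ↦ (S.comp Y a y : ℂ))
        (fun a ↦ (S.comp Z a y : ℂ))) x
    + dirC Y (fun y ↦ pairing (fun a b ↦ F a b y) (fun a ↦ (S.comp Z a y : ℂ))
        (fun a ↦ (S.comp X a y : ℂ))) x
    + dirC Z (fun y ↦ pairing (fun a b ↦ F a b y) (fun a ↦ (S.comp X a y : ℂ))
        (fun a ↦ (S.comp Y a y : ℂ))) x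
    - pairing (fun a b ↦ F a b x) (fun a ↦ (S.comp (bracket X Y) a x : ℂ)) (fun a ↦ (S.comp Z a x : ℂ))
    - pairing (fun a b ↦ F a b x) (fun a ↦ (S.comp (bracket Y Z) a x : ℂ)) (fun a ↦ (S.comp X a x : ℂ))
    - pairing (fun a b ↦ F a b x) (fun a ↦ (S.comp (bracket Z X) a x : ℂ)) (fun a ↦ (S.comp Y a x : ℂ))
      = 0
  have hsw := pairing_swap (F := fun a b ↦ F a b x) (fun a b ↦ hanti a b x)
  have hbr : ∀ {U V : VField M} (_ : VSmooth ∞ U) (_ : VSmooth ∞ V) (W : VField M),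
      pairing (fun a b ↦ F a b x) (fun a ↦ (S.comp (bracket U V) a x : ℂ))
        (fun a ↦ (S.comp W a x : ℂ)) =
      pairing (fun a b ↦ F a b x) (fun a ↦ (dirR U (S.comp V a) x : ℂ)) (fun a ↦ (S.comp W a x : ℂ))
      - pairing (fun a b ↦ F a b x) (fun a ↦ (dirR V (S.comp U a) x : ℂ))
        (fun a ↦ (S.comp W a x : ℂ))
      + ∑ a, ∑ b, ∑ c, (S.comp U a x : ℂ) * S.comp V b x * S.comp W c x
        * ∑ d, (S.struct a b d x : ℂ) * F d c x := by
    intro U V hU hV W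
    refine pairing_bracket _ _ _ _ _ (fun a ↦ (S.comp U a x : ℂ)) (fun a ↦ (S.comp V a x : ℂ))
      (fun a b d ↦ (S.struct a b d x : ℂ)) fun d ↦ ?_
    rw [S.comp_bracket hU hV]
    push_cast
    rfl
  have rot : ∀ (G : Fin 4 → Fin 4 → Fin 4 → ℂ), ∑ a, ∑ b, ∑ c, G a b c = ∑ a, ∑ b, ∑ c, G b c a := by
    intro G
    conv_rhs => rw [Finset.sum_comm]
    refine Finset.sum_congr rfl fun a _ ↦ ?_
    rw [Finset.sum_comm]
  rw [S.dirC_pairing (fun a b ↦ hF a b x) X hY hZ, S.dirC_pairing (fun a b ↦ hF a b x) Y hZ hX,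
    S.dirC_pairing (fun a b ↦ hF a b x) Z hX hY, hbr hX hY Z, hbr hY hZ X, hbr hZ hX Y,
    hsw (fun a ↦ (S.comp Y a x : ℂ)), hsw (fun a ↦ (S.comp Z a x : ℂ)),
    hsw (fun a ↦ (S.comp X a x : ℂ))]
  have hsum : ∑ a, ∑ b, ∑ c, (S.comp X a x : ℂ) * S.comp Y b x * S.comp Z c x *
      (dirC (S.vec a) (F b c) x + dirC (S.vec b) (F c a) x + dirC (S.vec c) (F a b) x
      - ∑ d, (S.struct a b d x : ℂ) * F d c x - ∑ d, (S.struct b c d x : ℂ) * F d a x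
      - ∑ d, (S.struct c a d x : ℂ) * F d b x) = 0 := by
    simp [hd]
  have rY := rot fun a b c ↦
    (S.comp Y a x : ℂ) * S.comp Z b x * S.comp X c x * dirC (S.vec a) (F b c) x
  have rZ := (rot fun a b c ↦
    (S.comp Z a x : ℂ) * S.comp X b x * S.comp Y c x * dirC (S.vec a) (F b c) x).trans (rot _)
  have rYZ := rot fun a b c ↦ (S.comp Y a x : ℂ) * S.comp Z b x * S.comp X c x *
    ∑ d, (S.struct a b d x : ℂ) * F d c x
  have rZX := (rot fun a b c ↦ (S.comp Z a x : ℂ) * S.comp X b x * S.comp Y c x *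
    ∑ d, (S.struct a b d x : ℂ) * F d c x).trans (rot _)
  have cY : ∀ a b c, (S.comp Y b x : ℂ) * S.comp Z c x * S.comp X a x =
      S.comp X a x * S.comp Y b x * S.comp Z c x := fun a b c ↦ by ring
  have cZ : ∀ a b c, (S.comp Z c x : ℂ) * S.comp X a x * S.comp Y b x =
      S.comp X a x * S.comp Y b x * S.comp Z c x := fun a b c ↦ by ring
  simp only [cY] at rY rYZ
  simp only [cZ] at rZ rZX
  simp only [cY, cZ]
  rw [rY, rZ, rYZ, rZX]
  simp only [mul_add, mul_sub, Finset.sum_add_distrib, Finset.sum_sub_distrib] at hsum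
  linear_combination hsum

/-- The two-form of a solution of the Maxwell equations is closed. -/
lemma IsMaxwell.isClosedForm {Φ : Spinor2 M} (hM : S.IsMaxwell Φ)
    (hΦ : ∀ A B x, MDifferentiableAt 𝓘(ℝ, E4) 𝓘(ℝ, ℂ) (fun y ↦ Φ y A B) x) :
    IsClosedForm (S.twoForm Φ) := by
  refine S.isClosedForm_of_tetrad (F := fun a b x ↦ fcomp (Φ x) a b)
    (fun a b x ↦ fcomp_antisymm (hM.1 x 1 0) a b)
    (fun a b x ↦ fcomp_mdifferentiableAt (fun A B ↦ hΦ A B x) a b) fun a b c x ↦ ?_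
  simp only [dirC_fcomp _ (fun A B ↦ hΦ A B x)]
  have hΓ : ∀ c a b, (mink a : ℂ) * S.conn c a b x = - (mink b * S.conn c b a x) := by
    intro c a b; exact_mod_cast S.mink_conn_antisymm c a b x
  have hG : ∀ c, dirC (S.vec c) (fun y ↦ Φ y 1 0) x = dirC (S.vec c) (fun y ↦ Φ y 0 1) x := by
    intro c; simp only [hM.1 _ 1 0]
  have cov := fun c ↦ fcomp_covariant (fun a b ↦ (S.conn c a b x : ℂ)) (hΓ c)
    (fun A B ↦ S.spinConn c A B x) (fun A B ↦ rfl) (Φ x)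
    (fun A B ↦ dirC (S.vec c) (fun y ↦ Φ y A B) x) (hM.1 x 1 0) (hG c)
  have cyc := fcomp_cyclic (fun c A B ↦ dirC (S.vec c) (fun y ↦ Φ y A B) x
    - ∑ D, S.spinConn c D A x * Φ x D B - ∑ D, S.spinConn c D B x * Φ x A D) (fun c ↦ by
      simp only [Fin.sum_univ_two, hG, hM.1 x 1 0]; ring) (hM.2 x) a b c
  rw [← cov, ← cov, ← cov] at cyc
  have anti := fcomp_antisymm (hM.1 x 1 0)
  simp only [fun (k : Fin 4 → ℂ) (b : Fin 4) ↦ (show ∑ d, k d * fcomp (Φ x) b d =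
    - ∑ d, k d * fcomp (Φ x) d b by
      rw [← Finset.sum_neg_distrib]
      exact Finset.sum_congr rfl fun d _ ↦ by rw [anti]; ring)] at cyc
  simp only [struct_eq, Complex.ofReal_sub, sub_mul, Finset.sum_sub_distrib]
  linear_combination cyc

end SpinFrame

end

end SpinGeom

end
theorem projKS_gives_maxwell {M : Type*} [TopologicalSpace M] [ChartedSpace E4 M]
    [IsManifold 𝓘(ℝ, E4) ω M] (g : LorentzMetric M) (S : SpinFrame g)
    -- a smooth spin dyad, `o_A ι^A = 1`
    (o ι : Spinor M) (ho : ∀ A, SSmooth (fun x ↦ o x A)) (hι : ∀ A, SSmooth (fun x ↦ ι x A))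
    (hdyad : ∀ x, ∑ A, lower o x A * ι x A = 1)
    (hsfr : S.IsShearFreeRay o) (hrep : S.IsRepeatedPrincipal o)
    (φ η : M → ℂ) (hφ : SSmooth φ) (hη : SSmooth η) (hf : S.IsDecomposition o ι φ η)
    (K₁ K₂ : M → ℂ) (hK₁ : SSmooth K₁) (hK₂ : SSmooth K₂)
    (hK : S.IsProjectedKilling o (ofComponents o ι 0 K₁ K₂))
    (c : ℂ) (hc : ∀ x, K₁ x = c * (φ x)⁻¹)
    (Φ : Spinor2 M) (hΦ : ∀ x A B, Φ x A B = -2 * φ x ^ 3 * ofComponents o ι 0 K₁ K₂ x A B) :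
    S.IsMaxwell Φ ∧ IsClosedForm (S.twoForm Φ) := by
  obtain rfl : Φ = fun x A B ↦ -2 * φ x ^ 3 * ofComponents o ι 0 K₁ K₂ x A B := by
    funext x A B; exact hΦ x A B
  have hM := S.maxwell_of_projectedKilling ho hι hdyad hφ hf hK₁ hK₂ hK hc
  refine ⟨hM, hM.isClosedForm S fun A B x ↦ ?_⟩
  have mφ := hφ.mdifferentiableAt x
  have m3 : MDifferentiableAt 𝓘(ℝ, E4) 𝓘(ℝ, ℂ) (fun y ↦ -2 * φ y ^ 3) x := by
    have e : (fun y ↦ -2 * φ y ^ 3) = fun y ↦ -2 * (φ y * (φ y * φ y)) := by funext y; ring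
    rw [e]
    exact mdifferentiableAt_fun_mul mdifferentiableAt_const
      (mdifferentiableAt_fun_mul mφ (mdifferentiableAt_fun_mul mφ mφ))
  exact mdifferentiableAt_fun_mul m3 (mdifferentiableAt_ofComponents ho hι hK₁ hK₂ x A B)
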